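/- arXiv:2301.11678 — 2 statements merged into one kernel-verified Lean document; each statement's English description precedes it below -/
import Mathlib

section
/- Let f : ℝ^n → ℝ be p times continuously differentiable (p ≥ 1). Let (x_k) be a sequence in ℝ^n converging to x_* ∈ ℝ^n with nonzero steps s_k = x_{k+1} − x_k, and let (W_k) be nonsingular matrices converging to a nonsingular matrix W_* ∈ ℝ^{n×n}. Assume the steps are uniformly linearly independent in the sense that there exist m ∈ ℕ, c < 1 and K ∈ ℕ such that for all k_0 ≥ K, ‖∏_{k=k_0}^{k_0+m−1} (I − (W_*^{-1}s_k s_k^T W_*^{-T})/(s_k^T W_*^{-T} W_*^{-1} s_k))‖_2 ≤ c. Let C_0 be any symmetric p-tensor and for each k let C_{k+1} be the unique symmetric p-tensor minimizing ‖(C − C_k)[W_k]^p‖_F over all symmetric p-tensors C satisfying C[s_k] = D^{p−1} f(x_{k+1}) − D^{p−1} f(x_k). Then C_k converges to D^p f(x_*) as k → ∞. -/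
open scoped BigOperators
open Matrix Filter

noncomputable section

/-- A `q`-tensor on `ℝ^n` (a multilinear map `(ℝ^n)^q → ℝ`), represented by its
coefficient array on the standard basis. -/
abbrev Tensor (n q : ℕ) := (Fin q → Fin n) → ℝ

namespace Tensor

/-- Evaluation of a tensor (as a multilinear map) on the vectors `u 0, …, u (q-1)`. -/
def eval {n q : ℕ} (T : Tensor n q) (u : Fin q → (Fin n → ℝ)) : ℝ :=
  ∑ i : Fin q → Fin n, T i * ∏ k, u k (i k)

/-- A tensor is symmetric if it is invariant under all permutations of its arguments. -/
def Symm {n q : ℕ} (T : Tensor n q) : Prop :=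
  ∀ σ : Equiv.Perm (Fin q), ∀ i : Fin q → Fin n, T (i ∘ σ) = T i

/-- The Frobenius norm of a tensor: the Euclidean norm of its coefficient array. -/
def frobNorm {n q : ℕ} (T : Tensor n q) : ℝ :=
  Real.sqrt (∑ i : Fin q → Fin n, (T i) ^ 2)

/-- The Frobenius inner product of two tensors. -/
def finner {n q : ℕ} (T S : Tensor n q) : ℝ := ∑ i : Fin q → Fin n, T i * S i

/-- The symmetric projection `P_sym(T) = (1/q!) ∑_σ σ(T)`. -/
def psym {n q : ℕ} (T : Tensor n q) : Tensor n q :=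
  fun i => ((Nat.factorial q : ℝ))⁻¹ * ∑ σ : Equiv.Perm (Fin q), T (i ∘ σ)

/-- `T[W]^q`: apply the matrix `W` to every argument of `T`. -/
def applyMat {n q : ℕ} (T : Tensor n q) (W : Matrix (Fin n) (Fin n) ℝ) : Tensor n q :=
  fun j => ∑ i : Fin q → Fin n, T i * ∏ k, W (i k) (j k)

/-- `T[v]^j`: fix the first `j` arguments of `T` to the vector `v`,
yielding a `(q-j)`-tensor. -/
def fixMany {n q : ℕ} (T : Tensor n q) (v : Fin n → ℝ) (j : ℕ) : Tensor n (q - j) :=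
  fun idx => ∑ i : Fin j → Fin n, (∏ k, v (i k)) *
    T (fun k => if h : (k : ℕ) < j then i ⟨k, h⟩
        else idx ⟨(k : ℕ) - j, by have hk := k.isLt; omega⟩)

/-- The outer product of two tensors. -/
def outer {n a b : ℕ} (T : Tensor n a) (S : Tensor n b) : Tensor n (a + b) :=
  fun idx => T (fun k => idx (Fin.castAdd b k)) * S (fun k => idx (Fin.natAdd a k))

/-- Reindexing a tensor along an equality of orders. -/
def castOrder {n a b : ℕ} (h : a = b) (T : Tensor n a) : Tensor n b :=
  fun idx => T (fun k => idx (Fin.cast h k))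

/-- Apply a matrix to the first argument of a tensor only. -/
def applyFirst {n q : ℕ} (hq : 0 < q) (T : Tensor n q) (M : Matrix (Fin n) (Fin n) ℝ) :
    Tensor n q :=
  fun idx => ∑ i : Fin n, M i (idx ⟨0, hq⟩) * T (Function.update idx ⟨0, hq⟩ i)

end Tensor

/-- `⊗^j v`, the `j`-fold outer product of a vector `v` with itself. -/
def vpow {n : ℕ} (j : ℕ) (v : Fin n → ℝ) : Tensor n j := fun idx => ∏ k, v (idx k)

/-- The Euclidean (2-) norm of a vector in `ℝ^n`. -/
def vnorm {n : ℕ} (v : Fin n → ℝ) : ℝ := Real.sqrt (∑ i, v i ^ 2)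

/-- The injective (2-) norm of a tensor:
the supremum of `|T[u_1,…,u_q]|` over unit vectors. -/
def Tensor.inj2Norm {n q : ℕ} (T : Tensor n q) : ℝ :=
  sSup ((fun u => |T.eval u|) '' {u : Fin q → Fin n → ℝ | ∀ k, vnorm (u k) = 1})

/-- The spectral (operator 2-) norm of a matrix. -/
def specNorm {n : ℕ} (M : Matrix (Fin n) (Fin n) ℝ) : ℝ :=
  ‖Matrix.toEuclideanCLM (𝕜 := ℝ) M‖

/-- The orthogonal projection `I - w wᵀ / (wᵀ w)` onto the orthogonal complement of `w`. -/
def projPerp {n : ℕ} (w : Fin n → ℝ) : Matrix (Fin n) (Fin n) ℝ :=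
  1 - (w ⬝ᵥ w)⁻¹ • Matrix.vecMulVec w w

/-- `Cp` is a least-change symmetric update of `Cb` in the `W`-weighted Frobenius norm,
subject to the secant equation `Cp[s] = R`. -/
def IsSecantUpdate {n p : ℕ} (Cb : Tensor n p) (R : Tensor n (p - 1))
    (W : Matrix (Fin n) (Fin n) ℝ) (s : Fin n → ℝ) (Cp : Tensor n p) : Prop :=
  Cp.Symm ∧ Cp.fixMany s 1 = R ∧
    ∀ C : Tensor n p, C.Symm → C.fixMany s 1 = R →
      ((Cp - Cb).applyMat W).frobNorm ≤ ((C - Cb).applyMat W).frobNorm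

/-- The explicit higher-order secant update formula of Theorem 1 (b):
`C• + ∑_{j=1}^p (-1)^{j+1} C(p,j) (vᵀs)^{-j} P_sym((⊗^j v) ⊗ (C̃ - C•)[s]^j)`. -/
def hosuFormula {n p : ℕ} (Cb Ct : Tensor n p) (v s : Fin n → ℝ) : Tensor n p :=
  Cb + ∑ j ∈ (Finset.Icc 1 p).attach,
    ((-1 : ℝ) ^ ((j : ℕ) + 1) * (p.choose (j : ℕ) : ℝ) * ((v ⬝ᵥ s) ^ (j : ℕ))⁻¹) •
      Tensor.castOrder (Nat.add_sub_cancel' (Finset.mem_Icc.mp j.2).2)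
        (Tensor.psym ((vpow (j : ℕ) v).outer ((Ct - Cb).fixMany s (j : ℕ))))

/-- The coefficient array of the `q`-th derivative of `f : ℝ^n → ℝ`
(domain given the sup-norm product structure). -/
def derivTensorPi {n : ℕ} (q : ℕ) (f : (Fin n → ℝ) → ℝ) (x : Fin n → ℝ) : Tensor n q :=
  fun idx => iteratedFDeriv ℝ q f x (fun k => Pi.single (idx k) 1)

/-- The coefficient array of the `q`-th derivative of `f : ℝ^n → ℝ`
(domain given the Euclidean structure). -/
def derivTensorE {n : ℕ} (q : ℕ) (f : EuclideanSpace ℝ (Fin n) → ℝ)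
    (x : EuclideanSpace ℝ (Fin n)) : Tensor n q :=
  fun idx => iteratedFDeriv ℝ q f x (fun k => EuclideanSpace.single (idx k) 1)

/-- Reinterpret a Euclidean vector as a plain vector in `Fin n → ℝ`. -/
def toVec {n : ℕ} (y : EuclideanSpace ℝ (Fin n)) : Fin n → ℝ := y

theorem iteratedFDeriv_comp_swap_castSucc_succ {E : Type*} [NormedAddCommGroup E]
    [NormedSpace ℝ E] {f : E → ℝ} {q : ℕ} (hf : ContDiff ℝ (q + 1 : ℕ) f) (i : Fin q)
    (y : E) (v : Fin (q + 1) → E) :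
    iteratedFDeriv ℝ (q + 1) f y (v ∘ Equiv.swap i.castSucc i.succ) =
      iteratedFDeriv ℝ (q + 1) f y v := by
  induction q generalizing y with
  | zero => exact i.elim0
  | succ q ih =>
    have hd : Differentiable ℝ (iteratedFDeriv ℝ (q + 1) f) :=
      hf.differentiable_iteratedFDeriv (by exact_mod_cast Nat.lt_succ_self (q + 1))
    refine Fin.cases ?_ (fun j => ?_) i
    · have hG : ContDiff ℝ 2 (iteratedFDeriv ℝ q f) :=
        hf.iteratedFDeriv_right (le_of_eq (by push_cast; ring))
      have key : ∀ u : Fin (q + 2) → E, iteratedFDeriv ℝ (q + 2) f y u =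
          fderiv ℝ (fderiv ℝ (iteratedFDeriv ℝ q f)) y (u 0) (u 1)
            (Fin.tail (Fin.tail u)) := by
        intro u
        have hG' := (hG.fderiv_right (m := 1) (by norm_num)).differentiable one_ne_zero y
        rw [(hd y).iteratedFDeriv_succ_apply_left']
        have h1 := hG'.hasFDerivAt.clm_apply (hasFDerivAt_const (u 1) y)
        have h2 := (ContinuousMultilinearMap.apply ℝ (fun _ : Fin q => E) ℝ
          (Fin.tail (Fin.tail u))).hasFDerivAt.comp y h1
        refine (congrArg (fun L => L (u 0)) h2.fderiv).trans ?_
        simp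
      rw [key, key]
      have hsymm := hG.contDiffAt.isSymmSndFDerivAt (x := y) (by simp) (v 0) (v 1)
      have htail : Fin.tail (Fin.tail (v ∘ Equiv.swap (0 : Fin (q + 1)).castSucc
          (0 : Fin (q + 1)).succ)) = Fin.tail (Fin.tail v) := by
        funext k
        simp only [Fin.tail, Function.comp_apply]
        rw [Equiv.swap_apply_of_ne_of_ne] <;> simp [Fin.ext_iff]
      rw [htail]
      simpa using DFunLike.congr_fun hsymm.symm (Fin.tail (Fin.tail v))
    · have hswap : v ∘ Equiv.swap j.succ.castSucc j.succ.succ =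
          Fin.cons (v 0) (Fin.tail v ∘ Equiv.swap j.castSucc j.succ) := by
        funext k
        refine Fin.cases ?_ (fun l => ?_) k
        · simp only [Function.comp_apply, Fin.cons_zero]
          rw [Equiv.swap_apply_of_ne_of_ne] <;> simp [Fin.ext_iff]
        · simp only [Function.comp_apply, Fin.cons_succ, Fin.tail, ← Fin.succ_castSucc]
          rw [(Fin.succ_injective _).swap_apply]
      rw [hswap, (hd y).iteratedFDeriv_succ_apply_left', (hd y).iteratedFDeriv_succ_apply_left']
      simp only [Fin.tail_cons, Fin.cons_zero]
      congr 2
      funext z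
      exact ih (hf.of_le (by norm_cast; omega)) j z _

/-- The iterated derivative of a real `C^q` function is a symmetric multilinear map. -/
theorem ContDiff.iteratedFDeriv_comp_perm_real {E : Type*} [NormedAddCommGroup E]
    [NormedSpace ℝ E] {f : E → ℝ} {q : ℕ} (hf : ContDiff ℝ q f) (σ : Equiv.Perm (Fin q))
    (y : E) (v : Fin q → E) :
    iteratedFDeriv ℝ q f y (v ∘ σ) = iteratedFDeriv ℝ q f y v := by
  cases q with
  | zero => rw [Subsingleton.elim (v ∘ σ) v]
  | succ q =>
    have hσ : σ ∈ Submonoid.closure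
        (Set.range fun i : Fin q => Equiv.swap i.castSucc i.succ) := by
      rw [Equiv.Perm.mclosure_swap_castSucc_succ]; trivial
    induction hσ using Submonoid.closure_induction generalizing v with
    | mem _ h =>
      obtain ⟨i, rfl⟩ := h
      exact iteratedFDeriv_comp_swap_castSucc_succ hf i y v
    | one => rfl
    | mul a b _ _ iha ihb =>
      rw [Equiv.Perm.coe_mul, ← Function.comp_assoc, ihb, iha]

/-- The average of the `q`-th derivative of `f` along the segment from `y` to `z`. -/
def segmentDerivTensor {n : ℕ} (q : ℕ) (f : (Fin n → ℝ) → ℝ) (y z : Fin n → ℝ) : Tensor n q :=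
  fun idx => ∫ t in (0 : ℝ)..1, derivTensorPi q f (y + t • (z - y)) idx

theorem continuous_derivTensorPi {n q : ℕ} {f : (Fin n → ℝ) → ℝ} (hf : ContDiff ℝ q f) :
    Continuous (derivTensorPi q f) := by
  refine continuous_pi fun idx => ?_
  have h : Continuous (iteratedFDeriv ℝ q f) := hf.continuous_iteratedFDeriv le_rfl
  exact (ContinuousMultilinearMap.apply ℝ (fun _ : Fin q => Fin n → ℝ) ℝ
    (fun k => Pi.single (idx k) 1)).continuous.comp h

theorem continuous_segmentDerivTensor {n q : ℕ} {f : (Fin n → ℝ) → ℝ} (hf : ContDiff ℝ q f) :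
    Continuous fun z : (Fin n → ℝ) × (Fin n → ℝ) => segmentDerivTensor q f z.1 z.2 := by
  refine continuous_pi fun idx => ?_
  refine intervalIntegral.continuous_parametric_intervalIntegral_of_continuous' ?_ 0 1
  exact (continuous_apply idx).comp ((continuous_derivTensorPi hf).comp (by fun_prop))

theorem segmentDerivTensor_self {n q : ℕ} (f : (Fin n → ℝ) → ℝ) (y : Fin n → ℝ) :
    segmentDerivTensor q f y y = derivTensorPi q f y := by
  funext idx; simp [segmentDerivTensor]

theorem tendsto_segmentDerivTensor {n q : ℕ} {f : (Fin n → ℝ) → ℝ} (hf : ContDiff ℝ q f)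
    {x : ℕ → Fin n → ℝ} {y : Fin n → ℝ} (hx : Tendsto x atTop (nhds y)) :
    Tendsto (fun k => segmentDerivTensor q f (x k) (x (k + 1))) atTop
      (nhds (derivTensorPi q f y)) := by
  have hpair : Tendsto (fun k => (x k, x (k + 1))) atTop (nhds (y, y)) :=
    hx.prodMk_nhds (hx.comp (tendsto_add_atTop_nat 1))
  have h := ((continuous_segmentDerivTensor hf).tendsto (y, y)).comp hpair
  rwa [segmentDerivTensor_self] at h

theorem segmentDerivTensor_symm {n q : ℕ} {f : (Fin n → ℝ) → ℝ} (hf : ContDiff ℝ q f)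
    (y z : Fin n → ℝ) : (segmentDerivTensor q f y z).Symm := by
  intro σ idx
  refine intervalIntegral.integral_congr fun t _ => ?_
  exact hf.iteratedFDeriv_comp_perm_real σ _ (fun k => Pi.single (idx k) 1)

namespace Tensor

theorem fixMany_one_apply {n q : ℕ} (T : Tensor n (q + 1)) (s : Fin n → ℝ) (idx : Fin q → Fin n) :
    T.fixMany s 1 idx = ∑ a, s a * T (Fin.cons a idx) := by
  unfold fixMany
  refine Fintype.sum_equiv (Equiv.funUnique (Fin 1) (Fin n)) _ _ fun i => ?_
  simp only [Finset.univ_unique, Fin.default_eq_zero, Finset.prod_singleton, Equiv.funUnique_apply]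
  congr 2
  funext k
  refine Fin.cases ?_ (fun l => ?_) k
  · simp
  · simp

end Tensor

theorem fixMany_segmentDerivTensor {n q : ℕ} {f : (Fin n → ℝ) → ℝ}
    (hf : ContDiff ℝ (q + 1 : ℕ) f) (y z : Fin n → ℝ) :
    (segmentDerivTensor (q + 1) f y z).fixMany (z - y) 1 =
      derivTensorPi q f z - derivTensorPi q f y := by
  funext idx
  have hcont : Continuous fun t : ℝ => derivTensorPi (q + 1) f (y + t • (z - y)) :=
    (continuous_derivTensorPi hf).comp (by fun_prop)
  have hd : Differentiable ℝ (iteratedFDeriv ℝ q f) :=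
    hf.differentiable_iteratedFDeriv (by exact_mod_cast Nat.lt_succ_self q)
  have hderiv : ∀ t : ℝ, HasDerivAt (fun t : ℝ => derivTensorPi q f (y + t • (z - y)) idx)
      (∑ a, (z - y) a * derivTensorPi (q + 1) f (y + t • (z - y)) (Fin.cons a idx)) t := by
    intro t
    have hline : HasDerivAt (fun t : ℝ => y + t • (z - y)) (z - y) t := by
      simpa using ((hasDerivAt_id t).smul_const (z - y)).const_add y
    have h1 := (hd (y + t • (z - y))).hasFDerivAt.comp_hasDerivAt t hline
    have h2 := (ContinuousMultilinearMap.apply ℝ (fun _ : Fin q => Fin n → ℝ) ℝ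
      (fun k => Pi.single (idx k) 1)).hasFDerivAt.comp_hasDerivAt t h1
    refine h2.congr_deriv ?_
    have hsum : z - y = ∑ a, (z - y) a • (Pi.single a 1 : Fin n → ℝ) := by
      funext b; simp [Finset.sum_apply, Pi.single_apply]
    conv_lhs => rw [hsum]
    simp only [map_sum, map_smul, smul_eq_mul]
    refine Finset.sum_congr rfl fun a _ => ?_
    rw [← hsum]
    rfl
  simp only [Tensor.fixMany_one_apply, segmentDerivTensor]
  have hint : ∀ i : Fin (q + 1) → Fin n, Continuous fun t : ℝ =>
      derivTensorPi (q + 1) f (y + t • (z - y)) i := fun i => (continuous_apply i).comp hcont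
  have := intervalIntegral.integral_eq_sub_of_hasDerivAt (a := 0) (b := 1)
    (fun t _ => hderiv t) (by
      refine Continuous.intervalIntegrable ?_ _ _
      exact continuous_finsetSum _ fun a _ => continuous_const.mul (hint _))
  have hii : ∀ a : Fin n, IntervalIntegrable (fun t : ℝ =>
      (z - y) a * derivTensorPi (q + 1) f (y + t • (z - y)) (Fin.cons a idx))
      MeasureTheory.volume 0 1 :=
    fun a => (continuous_const.mul (hint _)).intervalIntegrable _ _
  rw [intervalIntegral.integral_finsetSum fun a _ => hii a] at this
  simp only [intervalIntegral.integral_const_mul] at this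
  rw [this]
  simp

namespace Tensor

theorem sum_fin_succ_arrow {α M : Type*} [Fintype α] [AddCommMonoid M] {q : ℕ}
    (g : (Fin (q + 1) → α) → M) : ∑ i, g i = ∑ a, ∑ j : Fin q → α, g (Fin.cons a j) := by
  rw [← Fintype.sum_prod_type', ← (Fin.consEquiv fun _ : Fin (q + 1) => α).sum_comp]
  rfl

/-- The `q`-fold Kronecker power of a matrix, acting on coefficient arrays of `q`-tensors. -/
def kronPow {n : ℕ} (q : ℕ) (M : Matrix (Fin n) (Fin n) ℝ) :
    Matrix (Fin q → Fin n) (Fin q → Fin n) ℝ :=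
  Matrix.of fun i j => ∏ k, M (i k) (j k)

theorem applyMat_eq_vecMul {n q : ℕ} (T : Tensor n q) (M : Matrix (Fin n) (Fin n) ℝ) :
    T.applyMat M = T ᵥ* kronPow q M := rfl

theorem kronPow_mul {n : ℕ} (q : ℕ) (M N : Matrix (Fin n) (Fin n) ℝ) :
    kronPow q (M * N) = kronPow q M * kronPow q N := by
  ext i j
  simp only [kronPow, Matrix.of_apply, Matrix.mul_apply, Finset.prod_univ_sum,
    Fintype.piFinset_univ, Finset.prod_mul_distrib]

theorem kronPow_one {n : ℕ} (q : ℕ) : kronPow q (1 : Matrix (Fin n) (Fin n) ℝ) = 1 := by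
  ext i j
  simp only [kronPow, Matrix.of_apply, Matrix.one_apply, funext_iff]
  rw [Finset.prod_ite_zero]
  simp

theorem kronPow_transpose {n : ℕ} (q : ℕ) (M : Matrix (Fin n) (Fin n) ℝ) :
    kronPow q Mᵀ = (kronPow q M)ᵀ := rfl

theorem continuous_kronPow {n : ℕ} (q : ℕ) :
    Continuous (kronPow q : Matrix (Fin n) (Fin n) ℝ → _) := by
  refine continuous_matrix fun i j => ?_
  simp only [kronPow, Matrix.of_apply]
  exact continuous_finsetProd _ fun k _ =>
    (continuous_id (X := Matrix (Fin n) (Fin n) ℝ)).matrix_elem (i k) (j k)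

theorem kronPow_mulVec_cons {n q : ℕ} (M : Matrix (Fin n) (Fin n) ℝ) (v : Tensor n (q + 1))
    (a : Fin n) (i : Fin q → Fin n) :
    (kronPow (q + 1) M *ᵥ v) (Fin.cons a i) =
      ∑ b, M a b * (kronPow q M *ᵥ fun j => v (Fin.cons b j)) i := by
  simp only [Matrix.mulVec, dotProduct, sum_fin_succ_arrow, kronPow, Matrix.of_apply,
    Fin.prod_univ_succ, Fin.cons_zero, Fin.cons_succ, Finset.mul_sum, mul_assoc]

theorem vecMul_kronPow_cons {n q : ℕ} (M : Matrix (Fin n) (Fin n) ℝ) (T : Tensor n (q + 1))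
    (a : Fin n) (j : Fin q → Fin n) :
    (T ᵥ* kronPow (q + 1) M) (Fin.cons a j) =
      ∑ b, M b a * ((fun i => T (Fin.cons b i)) ᵥ* kronPow q M) j := by
  rw [← Matrix.mulVec_transpose, ← kronPow_transpose, kronPow_mulVec_cons]
  simp only [kronPow_transpose, Matrix.mulVec_transpose, Matrix.transpose_apply]

section Norm

open scoped Matrix.Norms.L2Operator

theorem sum_sq_mulVec_le {ι : Type*} [Fintype ι] [DecidableEq ι] (M : Matrix ι ι ℝ) (v : ι → ℝ) :
    ∑ i, (M *ᵥ v) i ^ 2 ≤ ‖M‖ ^ 2 * ∑ i, v i ^ 2 := by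
  have h := Matrix.l2_opNorm_mulVec M (WithLp.toLp 2 v)
  have h2 := pow_le_pow_left₀ (norm_nonneg _) h 2
  rw [mul_pow, EuclideanSpace.norm_sq_eq, EuclideanSpace.norm_sq_eq] at h2
  simpa using h2

theorem sum_sq_kronPow_mulVec_le {n q : ℕ} (M : Matrix (Fin n) (Fin n) ℝ) (v : Tensor n q) :
    ∑ i, (kronPow q M *ᵥ v) i ^ 2 ≤ (‖M‖ ^ q) ^ 2 * ∑ i, v i ^ 2 := by
  induction q with
  | zero => simp [kronPow, Matrix.mulVec, dotProduct]
  | succ q ih =>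
    simp only [sum_fin_succ_arrow, kronPow_mulVec_cons]
    rw [Finset.sum_comm]
    calc _ ≤ ∑ i : Fin q → Fin n, ‖M‖ ^ 2 *
          ∑ b, (kronPow q M *ᵥ fun j => v (Fin.cons b j)) i ^ 2 :=
          Finset.sum_le_sum fun i _ =>
            sum_sq_mulVec_le M fun b => (kronPow q M *ᵥ fun j => v (Fin.cons b j)) i
      _ = ‖M‖ ^ 2 * ∑ b, ∑ i, (kronPow q M *ᵥ fun j => v (Fin.cons b j)) i ^ 2 := by
          rw [← Finset.mul_sum, Finset.sum_comm]
      _ ≤ ‖M‖ ^ 2 * ∑ b, (‖M‖ ^ q) ^ 2 * ∑ j : Fin q → Fin n, v (Fin.cons b j) ^ 2 := by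
          gcongr with b
          exact ih _
      _ = _ := by rw [← Finset.mul_sum]; ring

theorem norm_kronPow_le {n : ℕ} (q : ℕ) (M : Matrix (Fin n) (Fin n) ℝ) :
    ‖kronPow q M‖ ≤ ‖M‖ ^ q := by
  rw [Matrix.cstar_norm_def]
  refine ContinuousLinearMap.opNorm_le_bound _ (by positivity) fun v => ?_
  refine le_of_sq_le_sq ?_ (by positivity)
  rw [mul_pow, EuclideanSpace.norm_sq_eq, EuclideanSpace.norm_sq_eq]
  simpa using sum_sq_kronPow_mulVec_le M v.ofLp

end Norm

theorem Symm.vecMul_kronPow {n q : ℕ} {T : Tensor n q} (hT : T.Symm)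
    (M : Matrix (Fin n) (Fin n) ℝ) : Symm (T ᵥ* kronPow q M) := by
  intro σ j
  simp only [Matrix.vecMul, dotProduct, kronPow, Matrix.of_apply]
  rw [← (Equiv.arrowCongr σ.symm (Equiv.refl (Fin n))).sum_comp]
  refine Finset.sum_congr rfl fun i _ => ?_
  have hi : Equiv.arrowCongr σ.symm (Equiv.refl (Fin n)) i = i ∘ σ := by ext; simp
  rw [hi, hT σ i]
  congr 1
  exact Equiv.prod_comp σ fun k => M (i k) (j k)

theorem Symm.add {n q : ℕ} {T S : Tensor n q} (hT : T.Symm) (hS : S.Symm) : (T + S).Symm :=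
  fun σ i => by simp [hT σ i, hS σ i]

theorem Symm.sub {n q : ℕ} {T S : Tensor n q} (hT : T.Symm) (hS : S.Symm) : (T - S).Symm :=
  fun σ i => by simp [hT σ i, hS σ i]

theorem fixMany_add {n q : ℕ} (T S : Tensor n q) (s : Fin n → ℝ) (j : ℕ) :
    (T + S).fixMany s j = T.fixMany s j + S.fixMany s j := by
  funext idx; simp [fixMany, mul_add, Finset.sum_add_distrib]

theorem fixMany_sub {n q : ℕ} (T S : Tensor n q) (s : Fin n → ℝ) (j : ℕ) :
    (T - S).fixMany s j = T.fixMany s j - S.fixMany s j := by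
  funext idx; simp [fixMany, mul_sub, Finset.sum_sub_distrib]

theorem fixMany_one_vecMul_kronPow_eq_zero {n q : ℕ} (T : Tensor n (q + 1))
    {M : Matrix (Fin n) (Fin n) ℝ} {s : Fin n → ℝ} (h : M *ᵥ s = 0) :
    fixMany (T ᵥ* kronPow (q + 1) M) s 1 = 0 := by
  funext idx
  simp only [fixMany_one_apply, vecMul_kronPow_cons, Finset.mul_sum]
  rw [Finset.sum_comm]
  refine Finset.sum_eq_zero fun b _ => ?_
  have hb : ∑ a, M b a * s a = 0 := congrFun h b
  rw [← zero_mul (((fun i => T (Fin.cons b i)) ᵥ* kronPow q M) idx), ← hb, Finset.sum_mul]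
  exact Finset.sum_congr rfl fun a _ => by ring

/-- Contracting any argument of a symmetric tensor is the same as contracting the first one. -/
theorem Symm.sum_update_eq_zero {n q : ℕ} {T : Tensor n (q + 1)} (hT : T.Symm) {s : Fin n → ℝ}
    (h : T.fixMany s 1 = 0) (k : Fin (q + 1)) (idx : Fin (q + 1) → Fin n) :
    ∑ a, s a * T (Function.update idx k a) = 0 := by
  have h0 := congrFun h (Fin.tail (idx ∘ Equiv.swap 0 k))
  rw [fixMany_one_apply] at h0
  refine Eq.trans (Finset.sum_congr rfl fun a _ => ?_) h0
  rw [← hT (Equiv.swap 0 k)]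
  congr 2
  funext l
  refine Fin.cases ?_ (fun l => ?_) l
  · simp
  · simp only [Function.comp_apply, Fin.cons_succ, Fin.tail]
    refine Function.update_of_ne ?_ _ _
    rw [Ne, ← Equiv.eq_symm_apply]
    simp [Fin.succ_ne_zero]

theorem vecMul_kronPow_one_sub_vecMulVec {n q : ℕ} {T : Tensor n q} {s : Fin n → ℝ}
    (h : ∀ k idx, ∑ a, s a * T (Function.update idx k a) = 0) (v : Fin n → ℝ) :
    T ᵥ* kronPow q (1 - Matrix.vecMulVec s v) = T := by
  induction q with
  | zero =>
    funext j
    simp [kronPow, Matrix.vecMul, dotProduct, Subsingleton.elim j default]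
  | succ q ih =>
    funext j
    obtain ⟨a, j, rfl⟩ : ∃ a j', j = Fin.cons a j' := ⟨j 0, Fin.tail j, by simp⟩
    rw [vecMul_kronPow_cons]
    have hb : ∀ b, (fun i => T (Fin.cons b i)) ᵥ* kronPow q (1 - Matrix.vecMulVec s v) =
        fun i => T (Fin.cons b i) := fun b => ih fun k idx => by
      simpa only [Fin.cons_update] using h k.succ (Fin.cons b idx)
    have h0 := h 0 (Fin.cons a j)
    simp only [Fin.update_cons_zero] at h0
    simp only [hb, Matrix.sub_apply, Matrix.one_apply, Matrix.vecMulVec_apply, sub_mul,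
      Finset.sum_sub_distrib, ite_mul, one_mul, zero_mul]
    have h1 : ∑ b, s b * v a * T (Fin.cons b j) = v a * ∑ b, s b * T (Fin.cons b j) := by
      rw [Finset.mul_sum]
      exact Finset.sum_congr rfl fun b _ => by ring
    rw [h1, h0]
    simp

end Tensor

theorem transpose_projPerp {n : ℕ} (w : Fin n → ℝ) : (projPerp w)ᵀ = projPerp w := by
  ext i j
  simp [projPerp, Matrix.vecMulVec_apply, Matrix.one_apply, mul_comm, eq_comm]

theorem projPerp_mulVec_self {n : ℕ} (w : Fin n → ℝ) : projPerp w *ᵥ w = 0 := by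
  rcases eq_or_ne w 0 with rfl | hw
  · simp
  · have : w ⬝ᵥ w ≠ 0 := fun h => hw (dotProduct_self_eq_zero.1 h)
    simp [projPerp, Matrix.sub_mulVec, Matrix.smul_mulVec, Matrix.vecMulVec_mulVec, smul_smul, this]

theorem projPerp_mul_self {n : ℕ} (w : Fin n → ℝ) : projPerp w * projPerp w = projPerp w := by
  conv_lhs => enter [2]; rw [projPerp]
  rw [mul_sub, mul_one, mul_smul_comm, Matrix.mul_vecMulVec, projPerp_mulVec_self]
  simp

theorem projPerp_smul {n : ℕ} {r : ℝ} (hr : r ≠ 0) (w : Fin n → ℝ) :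
    projPerp (r • w) = projPerp w := by
  ext i j
  simp only [projPerp, Matrix.sub_apply, Matrix.smul_apply, Matrix.vecMulVec_apply, Pi.smul_apply,
    smul_dotProduct, dotProduct_smul, smul_eq_mul]
  field_simp

theorem IsSecantUpdate.sub_eq_vecMul {n q : ℕ} {Cb A Cp : Tensor n (q + 1)}
    {W : Matrix (Fin n) (Fin n) ℝ} {s : Fin n → ℝ} (hCb : Cb.Symm) (hA : A.Symm)
    (hW : IsUnit W.det) (h : IsSecantUpdate Cb (A.fixMany s 1) W s Cp) :
    Cp - A = (Cb - A) ᵥ* Tensor.kronPow (q + 1) (W * projPerp (W⁻¹ *ᵥ s) * W⁻¹) := by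
  obtain ⟨hCp, hCps, hmin⟩ := h
  set w := W⁻¹ *ᵥ s with hw
  set P := projPerp w with hP
  set Q := W * P * W⁻¹ with hQ
  set D := Cb - A with hD
  set Dh : Tensor n (q + 1) := D ᵥ* Tensor.kronPow (q + 1) Q with hDh
  have hWi : W⁻¹ * W = 1 := Matrix.nonsing_inv_mul W hW
  have hiW : W * W⁻¹ = 1 := Matrix.mul_nonsing_inv W hW
  have hQW : Q * W = W * P := by rw [hQ, mul_assoc, hWi, mul_one]
  have hQs : Q *ᵥ s = 0 := by
    rw [hQ, ← Matrix.mulVec_mulVec, ← hw, ← Matrix.mulVec_mulVec, projPerp_mulVec_self,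
      Matrix.mulVec_zero]
  have hQform : Q = 1 - Matrix.vecMulVec s ((w ⬝ᵥ w)⁻¹ • (w ᵥ* W⁻¹)) := by
    have hWw : W *ᵥ w = s := by rw [hw, Matrix.mulVec_mulVec, hiW, Matrix.one_mulVec]
    rw [hQ, hP, projPerp, mul_sub, mul_one, sub_mul, hiW, mul_smul_comm, smul_mul_assoc,
      Matrix.mul_vecMulVec, Matrix.vecMulVec_mul, hWw, Matrix.vecMulVec_smul]
  have hDhS : Dh.Symm := (hCb.sub hA).vecMul_kronPow Q
  have hDhs : Dh.fixMany s 1 = 0 := Tensor.fixMany_one_vecMul_kronPow_eq_zero D hQs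
  set T := Cp - A - Dh with hT
  have hTS : T.Symm := (hCp.sub hA).sub hDhS
  have hTs : T.fixMany s 1 = 0 := by
    rw [hT, Tensor.fixMany_sub, Tensor.fixMany_sub, hCps, hDhs, sub_self, sub_zero]
  have hTQ : T ᵥ* Tensor.kronPow (q + 1) Q = T := by
    rw [hQform]
    exact Tensor.vecMul_kronPow_one_sub_vecMulVec (hTS.sum_update_eq_zero hTs) _
  set t := T ᵥ* Tensor.kronPow (q + 1) W with ht
  set g := (Dh - D) ᵥ* Tensor.kronPow (q + 1) W with hg
  have htP : t ᵥ* Tensor.kronPow (q + 1) P = t := by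
    conv_rhs => rw [ht, ← hTQ, Matrix.vecMul_vecMul, ← Tensor.kronPow_mul, hQW]
    rw [ht, Matrix.vecMul_vecMul, ← Tensor.kronPow_mul]
  have hgP : g ᵥ* Tensor.kronPow (q + 1) P = 0 := by
    rw [hg, hDh, Matrix.sub_vecMul, Matrix.sub_vecMul, Matrix.vecMul_vecMul, Matrix.vecMul_vecMul,
      Matrix.vecMul_vecMul, ← Tensor.kronPow_mul, ← Tensor.kronPow_mul, ← mul_assoc, hQW,
      mul_assoc, hP, projPerp_mul_self, sub_self]
  have htg : t ⬝ᵥ g = 0 := by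
    rw [← htP, ← Matrix.dotProduct_mulVec, ← Matrix.vecMul_transpose, ← Tensor.kronPow_transpose,
      hP, transpose_projPerp, ← hP, hgP, dotProduct_zero]
  have hle := hmin (A + Dh) (hA.add hDhS) (by rw [Tensor.fixMany_add, hDhs, add_zero])
  have e1 : A + Dh - Cb = Dh - D := by rw [hD]; abel
  have e2 : Cp - Cb = T + (Dh - D) := by rw [hT, hD]; abel
  rw [e1, e2, Tensor.applyMat_eq_vecMul, Tensor.applyMat_eq_vecMul, Matrix.add_vecMul, ← ht, ← hg,
    Tensor.frobNorm, Tensor.frobNorm, Real.sqrt_le_sqrt_iff (by positivity)] at hle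
  have hsq : ∀ u : Tensor n (q + 1), ∑ i, u i ^ 2 = u ⬝ᵥ u := fun u =>
    Finset.sum_congr rfl fun i _ => sq (u i)
  rw [hsq, hsq, add_dotProduct, dotProduct_add, dotProduct_add, dotProduct_comm g t, htg] at hle
  have ht0 : t = 0 := by
    refine dotProduct_self_eq_zero.1 (le_antisymm (by linarith) ?_)
    rw [← hsq]; positivity
  have hT0 : T = 0 := by
    have : t ᵥ* Tensor.kronPow (q + 1) W⁻¹ = T := by
      rw [ht, Matrix.vecMul_vecMul, ← Tensor.kronPow_mul, hiW, Tensor.kronPow_one,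
        Matrix.vecMul_one]
    rw [← this, ht0, Matrix.zero_vecMul]
  exact sub_eq_zero.1 hT0

/-- A nonnegative sequence that contracts over windows of length `m`, up to small errors,
tends to zero. -/
theorem tendsto_zero_of_eventually_window_contraction {a : ℕ → ℝ} (ha : ∀ k, 0 ≤ a k) {m : ℕ}
    (hm : 0 < m) {r : ℝ} (hr0 : 0 ≤ r) (hr : r < 1)
    (h : ∀ ε > 0, ∀ᶠ k in atTop, a (k + m) ≤ r * a k + ε) : Tendsto a atTop (nhds 0) := by
  rw [Metric.tendsto_atTop']
  intro δ hδ
  obtain ⟨N, hN⟩ := eventually_atTop.1 (h ((1 - r) * (δ / 2)) (by nlinarith))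
  set M := ∑ i ∈ Finset.range m, a (N + i) with hM
  have hbound : ∀ j, a (N + j) ≤ r ^ (j / m) * M + δ / 2 := by
    intro j
    induction j using Nat.strong_induction_on with
    | _ j ih =>
      rcases lt_or_ge j m with hj | hj
      · rw [Nat.div_eq_of_lt hj, pow_zero, one_mul]
        have := Finset.single_le_sum (f := fun i => a (N + i)) (fun i _ => ha _)
          (Finset.mem_range.2 hj)
        simp only [← hM] at this
        linarith
      · obtain ⟨i, rfl⟩ := Nat.exists_eq_add_of_le' hj
        have h1 := hN (N + i) (Nat.le_add_right _ _)
        have h2 := mul_le_mul_of_nonneg_left (ih i (by omega)) hr0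
        rw [Nat.add_div_right _ hm, pow_succ, ← add_assoc]
        nlinarith
  have hlim : Tendsto (fun j : ℕ => r ^ (j / m) * M) atTop (nhds 0) := by
    simpa using ((tendsto_pow_atTop_nhds_zero_of_lt_one hr0 hr).comp
      (Nat.tendsto_div_const_atTop hm.ne')).mul_const M
  obtain ⟨J, hJ⟩ := eventually_atTop.1 (hlim.eventually_lt_const (half_pos hδ))
  refine ⟨N + J, fun k hk => ?_⟩
  obtain ⟨j, rfl⟩ := Nat.exists_eq_add_of_le (show N ≤ k by omega)
  have h1 := hbound j
  have h2 := hJ j (by omega)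
  rw [Real.dist_eq, sub_zero, abs_of_nonneg (ha _)]
  linarith

/-- Convergence to zero of an inhomogeneous linear recursion whose propagators are asymptotic to
nonexpansive operators with contractive products `Φ k m` over windows of length `m`. -/
theorem tendsto_zero_of_perturbed_window_contraction {V : Type*} [NormedAddCommGroup V]
    [NormedSpace ℝ V] {L L' : ℕ → V →L[ℝ] V} {Φ : ℕ → ℕ → V →L[ℝ] V} {e δ : ℕ → V} {m K : ℕ}
    {r : ℝ} (hm : 0 < m) (hr0 : 0 ≤ r) (hr : r < 1) (hL' : ∀ k, ‖L' k‖ ≤ 1)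
    (hLL' : Tendsto (fun k => L k - L' k) atTop (nhds 0)) (hδ : Tendsto δ atTop (nhds 0))
    (hΦ0 : ∀ k, Φ k 0 = 1) (hΦ : ∀ k i, Φ k (i + 1) = L' (k + i) * Φ k i)
    (hΦm : ∀ k, K ≤ k → ‖Φ k m‖ ≤ r)
    (he : ∀ k, e (k + 1) = L k (e k - δ k) + δ k) : Tendsto e atTop (nhds 0) := by
  have hΦle : ∀ k i, ‖Φ k i‖ ≤ 1 := by
    intro k i
    induction i with
    | zero => rw [hΦ0]; exact ContinuousLinearMap.norm_id_le
    | succ i ih =>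
      rw [hΦ]
      exact (norm_mul_le _ _).trans (mul_le_one₀ (hL' _) (norm_nonneg _) ih)
  have hstep : ∀ k, e (k + 1) - L' k (e k) = (L k - L' k) (e k - δ k) + (δ k - L' k (δ k)) := by
    intro k
    rw [he]
    simp only [_root_.sub_apply, map_sub]
    abel
  have key : ∀ i, ∀ ε > 0, ∀ᶠ k in atTop, ‖e (k + i) - Φ k i (e k)‖ ≤ ε * (‖e k‖ + 1) := by
    intro i
    induction i with
    | zero =>
      intro ε hε
      refine Eventually.of_forall fun k => ?_
      simp only [add_zero, hΦ0, one_apply_eq_self, sub_self, norm_zero]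
      positivity
    | succ i ih =>
      intro ε hε
      have hη : 0 < min 1 (ε / 6) := by positivity
      have hshift : Tendsto (fun k => k + i) atTop atTop := tendsto_add_atTop_nat i
      have hA := (tendsto_zero_iff_norm_tendsto_zero.1 (hLL'.comp hshift)).eventually_lt_const hη
      have hB := (tendsto_zero_iff_norm_tendsto_zero.1 (hδ.comp hshift)).eventually_lt_const hη
      filter_upwards [ih _ hη, hA, hB] with k h1 h2 h3
      simp only [Function.comp_apply] at h2 h3
      set η := min 1 (ε / 6)
      have hη1 : η ≤ 1 := min_le_left _ _
      have hη2 : η ≤ ε / 6 := min_le_right _ _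
      have hek := norm_nonneg (e k)
      have hnorm : ‖e (k + i)‖ ≤ 2 * (‖e k‖ + 1) := by
        have h4 : ‖Φ k i (e k)‖ ≤ ‖e k‖ := by
          simpa using (Φ k i).le_of_opNorm_le (hΦle k i) (e k)
        have h5 := norm_le_norm_add_norm_sub' (e (k + i)) (Φ k i (e k))
        nlinarith
      have hsplit : e (k + (i + 1)) - Φ k (i + 1) (e k) =
          L' (k + i) (e (k + i) - Φ k i (e k)) +
            ((L (k + i) - L' (k + i)) (e (k + i) - δ (k + i)) +
              (δ (k + i) - L' (k + i) (δ (k + i)))) := by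
        rw [← hstep, hΦ, ← add_assoc, mul_apply_eq_comp, map_sub]
        abel
      have b1 : ‖L' (k + i) (e (k + i) - Φ k i (e k))‖ ≤ η * (‖e k‖ + 1) :=
        ((L' (k + i)).le_of_opNorm_le (hL' _) _).trans (by rw [one_mul]; exact h1)
      have b2 : ‖(L (k + i) - L' (k + i)) (e (k + i) - δ (k + i))‖ ≤
          η * (2 * (‖e k‖ + 1) + 1) := by
        refine ((L (k + i) - L' (k + i)).le_of_opNorm_le h2.le _).trans ?_
        gcongr
        exact (norm_sub_le _ _).trans (add_le_add hnorm (h3.le.trans hη1))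
      have b3 : ‖δ (k + i) - L' (k + i) (δ (k + i))‖ ≤ η + η := by
        refine (norm_sub_le _ _).trans (add_le_add h3.le ?_)
        exact ((L' (k + i)).le_of_opNorm_le (hL' _) _).trans (by rw [one_mul]; exact h3.le)
      rw [hsplit]
      refine (norm_add_le_of_le b1 (norm_add_le_of_le b2 b3)).trans ?_
      nlinarith
  refine tendsto_zero_iff_norm_tendsto_zero.2 (tendsto_zero_of_eventually_window_contraction
    (r := (r + 1) / 2) (fun k => norm_nonneg _) hm (by linarith) (by linarith) fun ε hε => ?_)
  have hη : 0 < min ((1 - r) / 2) ε := lt_min (by linarith) hε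
  filter_upwards [key m _ hη, eventually_ge_atTop K] with k h1 hk
  set η := min ((1 - r) / 2) ε
  have hη1 : η ≤ (1 - r) / 2 := min_le_left _ _
  have hη2 : η ≤ ε := min_le_right _ _
  have h2 := (Φ k m).le_of_opNorm_le (hΦm k hk) (e k)
  have h3 := norm_le_norm_add_norm_sub' (e (k + m)) (Φ k m (e k))
  nlinarith [norm_nonneg (e k)]

section Asymptotics

open scoped Matrix.Norms.L2Operator

theorem norm_projPerp_le_one {n : ℕ} (w : Fin n → ℝ) : ‖projPerp w‖ ≤ 1 := by
  have h := Matrix.l2_opNorm_conjTranspose_mul_self (projPerp w)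
  rw [Matrix.conjTranspose_eq_transpose_of_trivial, transpose_projPerp, projPerp_mul_self] at h
  by_contra! hlt
  nlinarith

theorem tendsto_conj_projPerp_sub {n : ℕ} {V : Type*} [NormedAddCommGroup V]
    {F : Matrix (Fin n) (Fin n) ℝ → V} (hF : Continuous F) {N : ℕ → Matrix (Fin n) (Fin n) ℝ}
    (hN : Tendsto N atTop (nhds 1)) {w : ℕ → Fin n → ℝ} (hw : ∀ k, w k ≠ 0) :
    Tendsto (fun k => F ((N k)⁻¹ * projPerp (N k *ᵥ w k) * N k) - F (projPerp (w k)))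
      atTop (nhds 0) := by
  let H : Matrix (Fin n) (Fin n) ℝ × (Fin n → ℝ) → V :=
    fun z => F (z.1⁻¹ * projPerp (z.1 *ᵥ z.2) * z.1)
  let S : Set (Matrix (Fin n) (Fin n) ℝ × (Fin n → ℝ)) := {1} ×ˢ Metric.sphere 0 1
  have hS : IsCompact S := isCompact_singleton.prod (isCompact_sphere _ _)
  have hH : ∀ z ∈ S, ContinuousAt H z := by
    rintro ⟨M, b⟩ ⟨hM, hb⟩
    obtain rfl : M = 1 := hM
    have hb0 : b ≠ 0 := by
      rintro rfl
      simp at hb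
    have hinv : ContinuousAt (fun z : Matrix (Fin n) (Fin n) ℝ × (Fin n → ℝ) => z.1⁻¹) (1, b) := by
      refine ContinuousAt.comp (g := Inv.inv) (continuousAt_matrix_inv _ ?_) continuousAt_fst
      rw [Ring.inverse_eq_inv']
      exact continuousAt_inv₀ (by simp)
    have hmul : Continuous fun z : Matrix (Fin n) (Fin n) ℝ × (Fin n → ℝ) => z.1 *ᵥ z.2 :=
      continuous_fst.matrix_mulVec continuous_snd
    have hproj : ContinuousAt
        (fun z : Matrix (Fin n) (Fin n) ℝ × (Fin n → ℝ) => projPerp (z.1 *ᵥ z.2)) (1, b) := by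
      refine ContinuousAt.sub continuousAt_const
        (ContinuousAt.fun_smul (ContinuousAt.fun_inv₀ ?_ ?_) ?_)
      · exact (hmul.dotProduct hmul).continuousAt
      · simpa using hb0
      · exact (hmul.matrix_vecMulVec hmul).continuousAt
    exact hF.continuousAt.comp ((hinv.mul hproj).mul continuousAt_fst)
  rw [Metric.tendsto_atTop']
  intro ε hε
  have huc := hS.uniformContinuousAt_of_continuousAt H hH (Metric.dist_mem_uniformity hε)
  let b : ℕ → Fin n → ℝ := fun k => ‖w k‖⁻¹ • w k
  have hlim : Tendsto (fun k => (((1 : Matrix (Fin n) (Fin n) ℝ), b k), (N k, b k))) atTop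
      (uniformity (Matrix (Fin n) (Fin n) ℝ × (Fin n → ℝ))) := by
    rw [uniformity_prod, tendsto_inf, tendsto_comap_iff, tendsto_comap_iff]
    exact ⟨Uniform.tendsto_nhds_right.1 hN, tendsto_diag_uniformity b atTop⟩
  obtain ⟨k₀, hk₀⟩ := eventually_atTop.1 (hlim.eventually huc)
  refine ⟨k₀, fun k hk => ?_⟩
  have hk' := hk₀ k hk.le ⟨rfl, by simp [b, norm_smul, hw k]⟩
  have hr : ‖w k‖⁻¹ ≠ 0 := by simpa using hw k
  simp only [Set.mem_ofPred_eq, H, b, Matrix.mulVec_smul, projPerp_smul hr, inv_one, one_mul,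
    mul_one, Matrix.one_mulVec] at hk'
  rwa [dist_zero_right, ← dist_eq_norm, dist_comm]

/-- The action `T ↦ T[M]^q` on `q`-tensors with the Frobenius norm. -/
def Tensor.applyCLM {n : ℕ} (q : ℕ) (M : Matrix (Fin n) (Fin n) ℝ) :
    EuclideanSpace ℝ (Fin q → Fin n) →L[ℝ] EuclideanSpace ℝ (Fin q → Fin n) :=
  Matrix.toEuclideanCLM (𝕜 := ℝ) (Tensor.kronPow q Mᵀ)

theorem Tensor.applyCLM_toLp {n q : ℕ} (M : Matrix (Fin n) (Fin n) ℝ) (T : Tensor n q) :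
    applyCLM q M (WithLp.toLp 2 T) = WithLp.toLp 2 (T ᵥ* kronPow q M) := by
  rw [applyCLM, Matrix.toEuclideanCLM_toLp, kronPow_transpose, Matrix.mulVec_transpose]

theorem Tensor.applyCLM_one {n : ℕ} (q : ℕ) :
    applyCLM q (1 : Matrix (Fin n) (Fin n) ℝ) = 1 := by
  rw [applyCLM, Matrix.transpose_one, kronPow_one, map_one]

theorem Tensor.applyCLM_mul {n : ℕ} (q : ℕ) (M N : Matrix (Fin n) (Fin n) ℝ) :
    applyCLM q (M * N) = applyCLM q N * applyCLM q M := by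
  rw [applyCLM, Matrix.transpose_mul, kronPow_mul, map_mul, applyCLM, applyCLM]

theorem Tensor.norm_applyCLM_le {n : ℕ} (q : ℕ) (M : Matrix (Fin n) (Fin n) ℝ) :
    ‖applyCLM q M‖ ≤ specNorm M ^ q := by
  refine (norm_kronPow_le q Mᵀ).trans_eq ?_
  rw [← Matrix.conjTranspose_eq_transpose_of_trivial, Matrix.l2_opNorm_conjTranspose]
  rfl

theorem Tensor.norm_applyCLM_projPerp_le_one {n : ℕ} (q : ℕ) (w : Fin n → ℝ) :
    ‖applyCLM q (projPerp w)‖ ≤ 1 :=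
  (norm_applyCLM_le q _).trans (pow_le_one₀ (norm_nonneg _) (norm_projPerp_le_one w))

theorem Tensor.continuous_applyCLM {n : ℕ} (q : ℕ) :
    Continuous (applyCLM q : Matrix (Fin n) (Fin n) ℝ → _) := by
  refine Continuous.comp (g := Matrix.toEuclideanCLM (𝕜 := ℝ)) ?_
    ((continuous_kronPow q).comp continuous_id.matrix_transpose)
  exact AddMonoidHomClass.continuous_of_bound
    (Matrix.toEuclideanCLM (n := Fin q → Fin n) (𝕜 := ℝ)) 1 fun M => (one_mul ‖M‖).ge

end Asymptotics

/-- global convergence of higher-order secant updates for uniformly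
linearly independent steps: `C_k → D^p f(x_*)`. -/
theorem statement13 (n p : ℕ) (hn : 1 ≤ n) (hp : 1 ≤ p)
    (f : (Fin n → ℝ) → ℝ) (hf : ContDiff ℝ p f)
    (x : ℕ → (Fin n → ℝ)) (xst : Fin n → ℝ) (hx : Tendsto x atTop (nhds xst))
    (hs : ∀ k, x (k + 1) - x k ≠ 0)
    (W : ℕ → Matrix (Fin n) (Fin n) ℝ) (hWk : ∀ k, IsUnit (W k).det)
    (Wst : Matrix (Fin n) (Fin n) ℝ) (hWst : IsUnit Wst.det)
    (hWlim : Tendsto W atTop (nhds Wst))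
    (m K : ℕ) (c : ℝ) (hc : c < 1)
    (hUnif : ∀ k0, K ≤ k0 →
      specNorm (((List.range m).map
        (fun i => projPerp (Wst⁻¹ *ᵥ (x (k0 + i + 1) - x (k0 + i))))).prod) ≤ c)
    (C : ℕ → Tensor n p) (hC0 : (C 0).Symm)
    (hupd : ∀ k, IsSecantUpdate (C k)
      (derivTensorPi (p - 1) f (x (k + 1)) - derivTensorPi (p - 1) f (x k))
      (W k) (x (k + 1) - x k) (C (k + 1))) :
    Tendsto C atTop (nhds (derivTensorPi p f xst)) := by
  obtain ⟨q, rfl⟩ : ∃ q, p = q + 1 := ⟨p - 1, by omega⟩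
  set B := derivTensorPi (q + 1) f xst
  set A : ℕ → Tensor n (q + 1) := fun k => segmentDerivTensor (q + 1) f (x k) (x (k + 1))
  have hAS : ∀ k, (A k).Symm := fun k => segmentDerivTensor_symm hf _ _
  have hCS : ∀ k, (C k).Symm := fun k => by
    cases k with
    | zero => exact hC0
    | succ k => exact (hupd k).1
  have hAlim : Tendsto A atTop (nhds B) := tendsto_segmentDerivTensor hf hx
  have hrec : ∀ k, C (k + 1) - A k = (C k - A k) ᵥ* Tensor.kronPow (q + 1)
      (W k * projPerp ((W k)⁻¹ *ᵥ (x (k + 1) - x k)) * (W k)⁻¹) := fun k => by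
    refine IsSecantUpdate.sub_eq_vecMul (hCS k) (hAS k) (hWk k) ?_
    rw [fixMany_segmentDerivTensor hf]
    exact hupd k
  have hWW : Wst * Wst⁻¹ = 1 := Matrix.mul_nonsing_inv Wst hWst
  set w : ℕ → Fin n → ℝ := fun k => Wst⁻¹ *ᵥ (x (k + 1) - x k) with hw
  have hWw : ∀ k, Wst *ᵥ w k = x (k + 1) - x k := fun k => by
    rw [hw, Matrix.mulVec_mulVec, hWW, Matrix.one_mulVec]
  have hw0 : ∀ k, w k ≠ 0 := fun k h => hs k (by rw [← hWw, h, Matrix.mulVec_zero])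
  set N : ℕ → Matrix (Fin n) (Fin n) ℝ := fun k => (W k)⁻¹ * Wst with hN
  have hNlim : Tendsto N atTop (nhds 1) := by
    have hinv : Tendsto (fun k => (W k)⁻¹) atTop (nhds Wst⁻¹) := by
      refine (continuousAt_matrix_inv Wst ?_).tendsto.comp hWlim
      rw [Ring.inverse_eq_inv']
      exact continuousAt_inv₀ hWst.ne_zero
    rw [← Matrix.nonsing_inv_mul Wst hWst]
    exact hinv.mul tendsto_const_nhds
  set R : ℕ → Matrix (Fin n) (Fin n) ℝ := fun k => (N k)⁻¹ * projPerp (N k *ᵥ w k) * N k with hR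
  have hWR : ∀ k, W k * projPerp ((W k)⁻¹ *ᵥ (x (k + 1) - x k)) * (W k)⁻¹ * Wst = Wst * R k := by
    intro k
    have hNw : N k *ᵥ w k = (W k)⁻¹ *ᵥ (x (k + 1) - x k) := by
      rw [hN, ← Matrix.mulVec_mulVec, hWw]
    have hNi : Wst * (N k)⁻¹ = W k := by
      rw [hN, Matrix.mul_inv_rev, ← mul_assoc, hWW, one_mul,
        Matrix.nonsing_inv_nonsing_inv _ (hWk k)]
    simp only [hR]
    rw [hNw, ← mul_assoc, ← mul_assoc, ← mul_assoc, hNi]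
  set toW : Tensor n (q + 1) → EuclideanSpace ℝ (Fin (q + 1) → Fin n) :=
    fun T => WithLp.toLp 2 (T ᵥ* Tensor.kronPow (q + 1) Wst) with htoW
  have htoW_cont : Continuous toW :=
    (PiLp.continuous_toLp 2 _).comp (continuous_id.matrix_vecMul continuous_const)
  have htoW_sub : ∀ T S, toW (T - S) = toW T - toW S := fun T S => by
    simp only [htoW, Matrix.sub_vecMul, WithLp.toLp_sub]
  have hδ : Tendsto (fun k => toW (A k - B)) atTop (nhds 0) := by
    have h0 : toW (B - B) = 0 := by rw [htoW_sub, sub_self]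
    rw [← h0]
    exact (htoW_cont.tendsto _).comp (hAlim.sub_const B)
  have hn0 : Nonempty (Fin n) := ⟨⟨0, hn⟩⟩
  have hc0 : 0 ≤ c := (norm_nonneg _).trans (hUnif K le_rfl)
  have hm : 0 < m := by
    rcases Nat.eq_zero_or_pos m with rfl | hm
    · have h1 := hUnif K le_rfl
      rw [List.range_zero, List.map_nil, List.prod_nil, specNorm, map_one, norm_one] at h1
      linarith
    · exact hm
  have hlim : Tendsto (fun k => toW (C k - B)) atTop (nhds 0) := by
    refine tendsto_zero_of_perturbed_window_contraction (K := K) (r := c ^ (q + 1))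
      (L := fun k => Tensor.applyCLM (q + 1) (R k))
      (L' := fun k => Tensor.applyCLM (q + 1) (projPerp (w k)))
      (Φ := fun k i => Tensor.applyCLM (q + 1)
        ((List.range i).map fun j => projPerp (w (k + j))).prod)
      hm (pow_nonneg hc0 _) (pow_lt_one₀ hc0 hc (Nat.succ_ne_zero q)) (fun k => ?_)
      (tendsto_conj_projPerp_sub (Tensor.continuous_applyCLM _) hNlim hw0) hδ (fun k => ?_)
      (fun k i => ?_) (fun k hk => ?_) (fun k => ?_)
    · exact Tensor.norm_applyCLM_projPerp_le_one _ _
    · exact Tensor.applyCLM_one _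
    · rw [List.range_succ, List.map_append, List.prod_append, Tensor.applyCLM_mul]
      simp
    · exact (Tensor.norm_applyCLM_le _ _).trans (pow_le_pow_left₀ (norm_nonneg _) (hUnif k hk) _)
    · rw [← sub_eq_iff_eq_add, ← htoW_sub, ← htoW_sub, sub_sub_sub_cancel_right,
        sub_sub_sub_cancel_right, hrec]
      simp only [htoW]
      rw [Tensor.applyCLM_toLp, Matrix.vecMul_vecMul, Matrix.vecMul_vecMul, ← Tensor.kronPow_mul,
        ← Tensor.kronPow_mul, hWR]
  have hback : ∀ T, (toW T).ofLp ᵥ* Tensor.kronPow (q + 1) Wst⁻¹ = T := fun T => by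
    simp only [htoW]
    rw [Matrix.vecMul_vecMul, ← Tensor.kronPow_mul, hWW, Tensor.kronPow_one, Matrix.vecMul_one]
  have hcont : Continuous fun v : EuclideanSpace ℝ (Fin (q + 1) → Fin n) =>
      v.ofLp ᵥ* Tensor.kronPow (q + 1) Wst⁻¹ :=
    (PiLp.continuous_ofLp 2 _).matrix_vecMul continuous_const
  have hfinal := (hcont.tendsto 0).comp hlim
  simp only [Function.comp_def, hback, WithLp.ofLp_zero, Matrix.zero_vecMul] at hfinal
  simpa using hfinal.add_const B
end
end

section
/- Let n, p ≥ 1, let C and C_* be symmetric p-tensors on ℝ^n, let W ∈ ℝ^{n×n} be nonsingular, let s ∈ ℝ^n be nonzero, and let P = I − (W^{-1}s s^T W^{-T})/(s^T W^{-T} W^{-1} s). Then ‖(C − C_*)[W]^p[P]^p‖_F^2 ≤ ‖(C − C_*)[W]^p‖_F^2 − (‖(C − C_*)[s]‖_F^2 / ‖s‖_2^2)·‖W^{-1}‖_2^{−2p}. -/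
open scoped BigOperators
open Matrix Filter

noncomputable section

namespace Tensor

variable {n q : ℕ}

/-- The sum of the squares of the coefficients of a tensor. -/
def normSq (T : Tensor n q) : ℝ := ∑ i, T i ^ 2

/-- Fix the first index of the coefficient array of a tensor. -/
def slice (T : Tensor n (q + 1)) (b : Fin n) : Tensor n q := fun i => T (Fin.cons b i)

theorem normSq_nonneg (T : Tensor n q) : 0 ≤ normSq T :=
  Finset.sum_nonneg fun _ _ => sq_nonneg _

theorem frobNorm_sq (T : Tensor n q) : T.frobNorm ^ 2 = normSq T :=
  Real.sq_sqrt (normSq_nonneg T)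

theorem sum_index_succ (f : (Fin (q + 1) → Fin n) → ℝ) :
    ∑ i, f i = ∑ b, ∑ i : Fin q → Fin n, f (Fin.cons b i) := by
  rw [← (Fin.consEquiv fun _ : Fin (q + 1) => Fin n).sum_comp, Fintype.sum_prod_type]
  rfl

theorem normSq_eq_sum_slice (T : Tensor n (q + 1)) : normSq T = ∑ b, normSq (slice T b) :=
  sum_index_succ _

theorem applyMat_sum_smul (c : Fin n → ℝ) (S : Fin n → Tensor n q)
    (M : Matrix (Fin n) (Fin n) ℝ) :
    (∑ b, c b • S b).applyMat M = ∑ b, c b • (S b).applyMat M := by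
  ext j
  simp only [applyMat, Finset.sum_apply, Pi.smul_apply, smul_eq_mul, Finset.sum_mul,
    Finset.mul_sum]
  rw [Finset.sum_comm]
  simp only [mul_assoc]

theorem slice_applyMat (T : Tensor n (q + 1)) (M : Matrix (Fin n) (Fin n) ℝ) (a : Fin n) :
    slice (T.applyMat M) a = ∑ b, M b a • (slice T b).applyMat M := by
  ext j
  simp only [slice, applyMat, sum_index_succ, Fin.prod_univ_succ, Fin.cons_zero, Fin.cons_succ,
    Finset.sum_apply, Pi.smul_apply, smul_eq_mul, Finset.mul_sum]
  exact Finset.sum_congr rfl fun b _ => Finset.sum_congr rfl fun i _ => by ring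

theorem ext_slice {T S : Tensor n (q + 1)} (h : ∀ b, slice T b = slice S b) : T = S := by
  ext i
  rw [← Fin.cons_self_tail i]
  exact congrFun (h (i 0)) (Fin.tail i)

theorem applyMat_mul (T : Tensor n q) (M N : Matrix (Fin n) (Fin n) ℝ) :
    (T.applyMat M).applyMat N = T.applyMat (M * N) := by
  induction q with
  | zero => ext j; simp [applyMat]
  | succ q ih =>
    refine ext_slice fun a => ?_
    simp only [slice_applyMat, applyMat_sum_smul, ih, Finset.smul_sum, smul_smul,
      Matrix.mul_apply, Finset.sum_smul]
    rw [Finset.sum_comm]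
    simp only [mul_comm]

theorem applyMat_one (T : Tensor n q) : T.applyMat 1 = T := by
  induction q with
  | zero => ext j; simp [applyMat, Subsingleton.elim j default]
  | succ q ih =>
    refine ext_slice fun a => ?_
    simp [slice_applyMat, ih, Matrix.one_apply]

theorem normSq_applyMat_le {M : Matrix (Fin n) (Fin n) ℝ} {c : ℝ} (hc : 0 ≤ c)
    (hM : ∀ v : Fin n → ℝ, (v ᵥ* M) ⬝ᵥ (v ᵥ* M) ≤ c * (v ⬝ᵥ v)) (T : Tensor n q) :
    normSq (T.applyMat M) ≤ c ^ q * normSq T := by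
  induction q with
  | zero => simp [normSq, applyMat]
  | succ q ih =>
    have hstep : normSq (T.applyMat M) ≤ c * ∑ b, normSq ((slice T b).applyMat M) := by
      simp only [normSq_eq_sum_slice, slice_applyMat]
      simp only [normSq]
      rw [Finset.sum_comm, Finset.sum_comm (s := Finset.univ (α := Fin n)), Finset.mul_sum]
      refine Finset.sum_le_sum fun j _ => ?_
      simpa [vecMul, dotProduct, pow_two, mul_comm] using
        hM fun b => (slice T b).applyMat M j
    calc normSq (T.applyMat M) ≤ c * ∑ b, normSq ((slice T b).applyMat M) := hstep
      _ ≤ c * ∑ b, c ^ q * normSq (slice T b) :=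
        mul_le_mul_of_nonneg_left (Finset.sum_le_sum fun b _ => ih _) hc
      _ = c ^ (q + 1) * normSq T := by
        rw [← Finset.mul_sum, ← normSq_eq_sum_slice, pow_succ]; ring

theorem fixMany_one (T : Tensor n (q + 1)) (v : Fin n → ℝ) :
    T.fixMany v 1 = ∑ b, v b • slice T b := by
  ext j
  simp only [fixMany, Finset.sum_apply, Pi.smul_apply, smul_eq_mul]
  rw [← (Equiv.funUnique (Fin 1) (Fin n)).symm.sum_comp]
  refine Finset.sum_congr rfl fun b _ => ?_
  congr 1
  · simp
  · refine congrArg T (funext fun k => ?_)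
    refine Fin.cases ?_ (fun k => ?_) k
    · simp
    · simp

theorem sum_smul_slice_applyMat (T : Tensor n (q + 1)) (M : Matrix (Fin n) (Fin n) ℝ)
    (v : Fin n → ℝ) :
    ∑ a, v a • slice (T.applyMat M) a = (∑ b, (M *ᵥ v) b • slice T b).applyMat M := by
  rw [applyMat_sum_smul]
  simp only [slice_applyMat, Finset.smul_sum, smul_smul, mulVec, dotProduct, Finset.sum_smul]
  rw [Finset.sum_comm]
  simp only [mul_comm]

end Tensor

theorem vecMul_projPerp {n : ℕ} (w v : Fin n → ℝ) :
    v ᵥ* projPerp w = v - ((w ⬝ᵥ w)⁻¹ * (v ⬝ᵥ w)) • w := by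
  rw [projPerp, vecMul_sub, vecMul_one, vecMul_smul, vecMul_vecMulVec, smul_smul]

theorem dotProduct_vecMul_projPerp {n : ℕ} {w : Fin n → ℝ} (hw : w ≠ 0) (v : Fin n → ℝ) :
    (v ᵥ* projPerp w) ⬝ᵥ (v ᵥ* projPerp w) = v ⬝ᵥ v - (v ⬝ᵥ w) ^ 2 / (w ⬝ᵥ w) := by
  have h : w ⬝ᵥ w ≠ 0 := fun h => hw (dotProduct_self_eq_zero.mp h)
  rw [vecMul_projPerp]
  simp only [sub_dotProduct, dotProduct_sub, smul_dotProduct, dotProduct_smul, smul_eq_mul,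
    dotProduct_comm w v]
  field_simp
  ring

theorem dotProduct_self_nonneg_real {n : ℕ} (v : Fin n → ℝ) : 0 ≤ v ⬝ᵥ v :=
  Finset.sum_nonneg fun _ _ => mul_self_nonneg _

theorem Tensor.normSq_applyMat_projPerp_le {n q : ℕ} (A : Tensor n (q + 1)) {w : Fin n → ℝ}
    (hw : w ≠ 0) :
    (A.applyMat (projPerp w)).normSq
      ≤ A.normSq - (∑ b, w b • A.slice b).normSq / (w ⬝ᵥ w) := by
  have hP : ∀ v : Fin n → ℝ,
      (v ᵥ* projPerp w) ⬝ᵥ (v ᵥ* projPerp w) ≤ 1 * (v ⬝ᵥ v) := fun v => by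
    rw [dotProduct_vecMul_projPerp hw, one_mul]
    exact sub_le_self _ (div_nonneg (sq_nonneg _) (dotProduct_self_nonneg_real w))
  calc (A.applyMat (projPerp w)).normSq
      = ∑ a, ((∑ b, projPerp w b a • A.slice b).applyMat (projPerp w)).normSq := by
        simp only [normSq_eq_sum_slice, slice_applyMat, applyMat_sum_smul]
    _ ≤ ∑ a, (∑ b, projPerp w b a • A.slice b).normSq := by
        refine Finset.sum_le_sum fun a _ => ?_
        simpa using normSq_applyMat_le zero_le_one hP (∑ b, projPerp w b a • A.slice b)
    _ = A.normSq - (∑ b, w b • A.slice b).normSq / (w ⬝ᵥ w) := by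
        rw [normSq_eq_sum_slice A]
        simp only [normSq]
        rw [Finset.sum_comm, Finset.sum_comm (s := Finset.univ (α := Fin n)), Finset.sum_div,
          ← Finset.sum_sub_distrib]
        refine Finset.sum_congr rfl fun j _ => ?_
        simpa [vecMul, dotProduct, pow_two, mul_comm] using
          dotProduct_vecMul_projPerp hw fun b => A.slice b j

theorem vnorm_sq {n : ℕ} (v : Fin n → ℝ) : vnorm v ^ 2 = v ⬝ᵥ v := by
  rw [vnorm, Real.sq_sqrt (Finset.sum_nonneg fun _ _ => sq_nonneg _)]
  simp [dotProduct, pow_two]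

theorem dotProduct_mulVec_self_le {n : ℕ} (M : Matrix (Fin n) (Fin n) ℝ) (v : Fin n → ℝ) :
    (M *ᵥ v) ⬝ᵥ (M *ᵥ v) ≤ specNorm M ^ 2 * (v ⬝ᵥ v) := by
  have hnorm : ∀ u : Fin n → ℝ, ‖WithLp.toLp 2 u‖ ^ 2 = u ⬝ᵥ u := fun u => by
    rw [EuclideanSpace.norm_sq_eq]
    simp [dotProduct, pow_two]
  have h := (toEuclideanCLM (𝕜 := ℝ) M).le_opNorm (WithLp.toLp 2 v)
  rw [toEuclideanCLM_toLp] at h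
  rw [← hnorm, ← hnorm, ← mul_pow]
  exact pow_le_pow_left₀ (norm_nonneg _) h 2

theorem specNorm_transpose {n : ℕ} (M : Matrix (Fin n) (Fin n) ℝ) :
    specNorm Mᵀ = specNorm M := by
  rw [specNorm, specNorm, ← conjTranspose_eq_transpose_of_trivial, ← star_eq_conjTranspose,
    map_star, ContinuousLinearMap.star_eq_adjoint, LinearIsometryEquiv.norm_map]

theorem dotProduct_vecMul_self_le {n : ℕ} (M : Matrix (Fin n) (Fin n) ℝ) (v : Fin n → ℝ) :
    (v ᵥ* M) ⬝ᵥ (v ᵥ* M) ≤ specNorm M ^ 2 * (v ⬝ᵥ v) := by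
  rw [← mulVec_transpose, ← specNorm_transpose]
  exact dotProduct_mulVec_self_le _ _

/-- the Frobenius-norm decrease estimate
`‖(C - C_*)[W]^p[P]^p‖_F² ≤ ‖(C - C_*)[W]^p‖_F² - (‖(C - C_*)[s]‖_F²/‖s‖₂²)‖W⁻¹‖₂^{-2p}`. -/
theorem statement19 (n p : ℕ) (hn : 1 ≤ n) (hp : 1 ≤ p)
    (C Cst : Tensor n p) (hC : C.Symm) (hCst : Cst.Symm)
    (W : Matrix (Fin n) (Fin n) ℝ) (hW : IsUnit W.det)
    (s : Fin n → ℝ) (hs : s ≠ 0) :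
    (((C - Cst).applyMat W).applyMat (projPerp (W⁻¹ *ᵥ s))).frobNorm ^ 2
      ≤ ((C - Cst).applyMat W).frobNorm ^ 2
        - ((C - Cst).fixMany s 1).frobNorm ^ 2 / vnorm s ^ 2
          * (specNorm W⁻¹ ^ (2 * p))⁻¹ := by
  obtain ⟨q, rfl⟩ : ∃ q, p = q + 1 := ⟨p - 1, by omega⟩
  set T := C - Cst
  set w := W⁻¹ *ᵥ s with hw_def
  have hWw : W *ᵥ w = s := by rw [hw_def, mulVec_mulVec, mul_nonsing_inv W hW, one_mulVec]
  have hw : w ≠ 0 := fun h => hs (by rw [← hWw, h, mulVec_zero])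
  have hpos : ∀ {v : Fin n → ℝ}, v ≠ 0 → 0 < v ⬝ᵥ v := fun {v} hv =>
    (dotProduct_self_nonneg_real v).lt_of_ne' fun h => hv (dotProduct_self_eq_zero.mp h)
  set D : Tensor n q := ∑ b, s b • T.slice b with hD
  have hfix : (T.fixMany s 1).frobNorm ^ 2 = D.normSq := by
    rw [Tensor.fixMany_one]; exact Tensor.frobNorm_sq D
  have hDW : D.normSq ≤ (specNorm W⁻¹ ^ 2) ^ q * (D.applyMat W).normSq := by
    have h := Tensor.normSq_applyMat_le (sq_nonneg _) (dotProduct_vecMul_self_le W⁻¹)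
      (D.applyMat W)
    rwa [Tensor.applyMat_mul, mul_nonsing_inv W hW, Tensor.applyMat_one] at h
  have hws : w ⬝ᵥ w ≤ specNorm W⁻¹ ^ 2 * (s ⬝ᵥ s) := dotProduct_mulVec_self_le _ _
  have hκ : 0 < specNorm W⁻¹ ^ 2 :=
    pos_of_mul_pos_left ((hpos hw).trans_le hws) (hpos hs).le
  have hmain := Tensor.normSq_applyMat_projPerp_le (T.applyMat W) hw
  rw [Tensor.sum_smul_slice_applyMat, hWw, ← hD] at hmain
  rw [Tensor.frobNorm_sq, Tensor.frobNorm_sq, hfix, vnorm_sq, pow_mul]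
  refine hmain.trans (sub_le_sub_left ?_ _)
  rw [← div_eq_mul_inv, div_div, div_le_div_iff₀ (mul_pos (hpos hs) (pow_pos hκ _)) (hpos hw)]
  calc D.normSq * (w ⬝ᵥ w)
      ≤ ((specNorm W⁻¹ ^ 2) ^ q * (D.applyMat W).normSq) * (specNorm W⁻¹ ^ 2 * (s ⬝ᵥ s)) :=
        mul_le_mul hDW hws (hpos hw).le
          (mul_nonneg (pow_nonneg hκ.le _) (Tensor.normSq_nonneg _))
    _ = (D.applyMat W).normSq * ((s ⬝ᵥ s) * (specNorm W⁻¹ ^ 2) ^ (q + 1)) := by ring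
end
end
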